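/- Let (R,m) be a Noetherian local ring with completion R̂, E = E(R/m), and 0 ≠ N ⊆ E a submodule with B = Ann_{R̂}(N). Then N is a divisible R-module if and only if for every associated prime P of R̂/B, the contraction P ∩ R is not a regular ideal (contains no non-zerodivisor of R). -/

import Mathlib

open IsLocalRing in
theorem isFiniteLength_quotient_maximalIdeal_pow {R : Type*} [CommRing R] [IsNoetherianRing R]
    [IsLocalRing R] (n : ℕ) : IsFiniteLength R (R ⧸ maximalIdeal R ^ n) := by
  have hA : IsArtinianRing (R ⧸ maximalIdeal R ^ n) := by
    rcases Nat.eq_zero_or_pos n with rfl | hn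
    · have : Subsingleton (R ⧸ maximalIdeal R ^ 0) :=
        Ideal.Quotient.subsingleton_iff.mpr (by simp [Ideal.one_eq_top])
      infer_instance
    · refine quotient_artinian_of_mem_minimalPrimes_of_isLocalRing _ ?_
      refine ⟨⟨inferInstance, Ideal.pow_le_self hn.ne'⟩, fun J hJ _ ↦ ?_⟩
      exact hJ.1.le_of_pow_le hJ.2
  have : IsArtinian R (R ⧸ maximalIdeal R ^ n) :=
    isArtinian_of_surjective_algebraMap (R := R ⧸ maximalIdeal R ^ n)
      (Ideal.Quotient.mk_surjective (I := maximalIdeal R ^ n))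
  exact isFiniteLength_iff_isNoetherian_isArtinian.mpr ⟨inferInstance, this⟩

theorem exists_pow_smul_eq_zero_of_essential {R E : Type*} [CommRing R] [IsNoetherianRing R]
    [AddCommGroup E] [Module R E] (I : Ideal R) (S : Submodule R E) (hS : I • S = ⊥)
    (hess : ∀ U : Submodule R E, U ≠ ⊥ → U ⊓ S ≠ ⊥) (x : E) :
    ∃ n : ℕ, ∀ a ∈ I ^ n, a • x = 0 := by
  let M := Submodule.span R {x}
  obtain ⟨k, hk⟩ := I.exists_pow_inf_eq_pow_smul (S.comap M.subtype)
  have hle : I ^ (k + 1) • (⊤ : Submodule R M) ⊓ S.comap M.subtype ≤ ⊥ := by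
    rw [hk (k + 1) (Nat.le_succ k), Nat.add_sub_cancel_left, pow_one]
    refine (Submodule.smul_mono le_rfl inf_le_right).trans ?_
    rw [← Submodule.map_le_map_iff_of_injective M.subtype_injective, Submodule.map_smul'',
      Submodule.map_bot, ← hS]
    exact Submodule.smul_mono le_rfl (Submodule.map_comap_le _ _)
  have hbot : (I ^ (k + 1) • (⊤ : Submodule R M)).map M.subtype = ⊥ := by
    by_contra h
    refine hess _ h (le_bot_iff.mp ?_)
    rintro _ ⟨⟨y, hy, rfl⟩, hyS⟩
    rw [(Submodule.mem_bot R).mp (hle ⟨hy, hyS⟩), map_zero]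
    exact Submodule.zero_mem _
  refine ⟨k + 1, fun a ha ↦ (Submodule.mem_bot R).mp (hbot ▸ ?_)⟩
  exact ⟨a • ⟨x, Submodule.mem_span_singleton_self x⟩,
    Submodule.smul_mem_smul ha Submodule.mem_top, rfl⟩

theorem length_linearMap_le_length {R E M : Type*} [CommRing R] [AddCommGroup E] [Module R E]
    (S : Submodule R E) [IsSimpleModule R S]
    (hess : ∀ U : Submodule R E, U ≠ ⊥ → U ⊓ S ≠ ⊥)
    [AddCommGroup M] [Module R M] (hM : IsFiniteLength R M) :
    Module.length R (M →ₗ[R] E) ≤ Module.length R M := by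
  induction hM with
  | @of_subsingleton M _ _ _ =>
    have : Subsingleton (M →ₗ[R] E) := ⟨fun f g ↦ by ext x; simp [Subsingleton.elim x 0]⟩
    simp
  | @of_simple_quotient M _ _ K _ _ ih =>
    have hsimple : Module.length R (M ⧸ K →ₗ[R] E) ≤ Module.length R (M ⧸ K) := by
      have := IsSimpleModule.nontrivial R (M ⧸ K)
      obtain ⟨s, hs⟩ := exists_ne (0 : M ⧸ K)
      have hrange (φ : M ⧸ K →ₗ[R] E) : LinearMap.range φ ≤ S := by
        by_cases hφ : LinearMap.range φ = ⊥
        · simp [hφ]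
        · have hc : S.comap φ = ⊤ := by
            refine (eq_bot_or_eq_top _).resolve_left fun h ↦ hess _ hφ ?_
            rw [← Submodule.map_comap_eq, h, Submodule.map_bot]
          rintro _ ⟨y, rfl⟩
          exact Submodule.mem_comap.mp (hc ▸ Submodule.mem_top)
      let ev : (M ⧸ K →ₗ[R] E) →ₗ[R] S :=
        LinearMap.codRestrict S (LinearMap.applyₗ s) fun φ ↦ hrange φ ⟨s, rfl⟩
      have hev : Function.Injective ev := by
        rw [injective_iff_map_eq_zero]
        intro φ hφ
        have h0 : φ s = 0 := congrArg Subtype.val hφ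
        have hk : LinearMap.ker φ = ⊤ :=
          (eq_bot_or_eq_top _).resolve_left fun h ↦ hs (by
            rw [← Submodule.mem_bot R, ← h]; exact h0)
        exact LinearMap.ker_eq_top.mp hk
      refine (Module.length_le_of_injective ev hev).trans ?_
      rw [Module.length_eq_one, Module.length_eq_one]
    let res : (M →ₗ[R] E) →ₗ[R] (K →ₗ[R] E) := LinearMap.lcomp R E K.subtype
    let des : LinearMap.ker res →ₗ[R] (M ⧸ K →ₗ[R] E) :=
      { toFun := fun φ ↦ K.liftQ φ.1 fun x hx ↦ LinearMap.congr_fun φ.2 ⟨x, hx⟩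
        map_add' := fun _ _ ↦ by ext; rfl
        map_smul' := fun _ _ ↦ by ext; rfl }
    have hdes : Function.Injective des := by
      intro φ ψ h
      ext x
      exact LinearMap.congr_fun h (K.mkQ x)
    rw [Module.length_eq_add_of_exact (LinearMap.ker res).subtype res.rangeRestrict
      (Submodule.subtype_injective _) res.surjective_rangeRestrict
      (by rw [LinearMap.exact_iff, LinearMap.ker_rangeRestrict, Submodule.range_subtype]),
      Module.length_eq_add_of_exact K.subtype K.mkQ
      (Submodule.subtype_injective _) K.mkQ_surjective (LinearMap.exact_subtype_mkQ K), add_comm]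
    exact add_le_add
      ((Module.length_le_of_injective _ (Submodule.subtype_injective _)).trans ih)
      ((Module.length_le_of_injective des hdes).trans hsimple)

open IsLocalRing in
theorem exists_linearMap_apply_ne_zero {R E M : Type*} [CommRing R] [IsLocalRing R]
    [AddCommGroup E] [Module R E] [AddCommGroup M] [Module R M] (hE : Module.Baer R E)
    (ι : ResidueField R →ₗ[R] E) (hι : Function.Injective ι) {m : M} (hm : m ≠ 0) :
    ∃ φ : M →ₗ[R] E, φ m ≠ 0 := by
  let K := LinearMap.ker (LinearMap.toSpanSingleton R M m)
  have hK : K ≤ LinearMap.ker (ι ∘ₗ Algebra.linearMap R (ResidueField R)) := by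
    have hK' : K ≤ maximalIdeal R :=
      le_maximalIdeal fun h ↦ hm (by simpa [K] using (Ideal.eq_top_iff_one K).mp h)
    intro r hr
    have : residue R r = 0 := (residue_eq_zero_iff r).mpr (hK' hr)
    simp [ResidueField.algebraMap_eq, this]
  obtain ⟨φ, hφ⟩ := hE.extension_property (K.liftQ _ le_rfl)
    (LinearMap.ker_eq_bot.mp (Submodule.ker_liftQ_eq_bot' _ _ rfl)) (K.liftQ _ hK)
  refine ⟨φ, fun h ↦ one_ne_zero (α := ResidueField R) (hι ?_)⟩
  have h1 : φ ((1 : R) • m) = ι (algebraMap R (ResidueField R) 1) :=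
    LinearMap.congr_fun hφ (K.mkQ 1)
  simpa [h] using h1.symm

open IsLocalRing in
theorem smul_mem_of_smul_torsion_eq_zero {R E : Type*} [CommRing R] [IsLocalRing R]
    [AddCommGroup E] [Module R E] (hE : Module.Baer R E)
    (ι : ResidueField R →ₗ[R] E) (hι : Function.Injective ι) (J : Ideal R) {r : R}
    (hr : ∀ x ∈ Submodule.torsionBySet R E J, r • x = 0) : r ∈ J := by
  by_contra h
  obtain ⟨φ, hφ⟩ := exists_linearMap_apply_ne_zero hE ι hι
    (m := Ideal.Quotient.mk J r) (by rwa [Ne, Ideal.Quotient.eq_zero_iff_mem])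
  have hmk (a : R) : a • φ 1 = φ (Ideal.Quotient.mk J a) := by
    rw [← map_smul, Algebra.smul_def, mul_one]; rfl
  refine hφ ?_
  rw [← hmk, hr]
  rw [Submodule.mem_torsionBySet_iff]
  rintro ⟨a, ha⟩
  rw [hmk, Ideal.Quotient.eq_zero_iff_mem.mpr ha, map_zero]

open IsLocalRing in
theorem exists_eq_smul_subtype_torsion {R E : Type*} [CommRing R] [IsLocalRing R]
    [AddCommGroup E] [Module R E] (hE : Module.Baer R E)
    (ι : ResidueField R →ₗ[R] E) (hι : Function.Injective ι)
    (hess : ∀ U : Submodule R E, U ≠ ⊥ → U ⊓ LinearMap.range ι ≠ ⊥)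
    (J : Ideal R) (hJ : IsFiniteLength R (R ⧸ J))
    (f : Submodule.torsionBySet R E J →ₗ[R] E) :
    ∃ r : R, f = r • (Submodule.torsionBySet R E J).subtype := by
  let T := Submodule.torsionBySet R E (J : Set R)
  have : IsSimpleModule R (LinearMap.range ι) :=
    have : IsSimpleModule R (ResidueField R) :=
      isSimpleModule_iff_isCoatom.mpr (IsLocalRing.maximalIdeal.isMaximal R).out
    IsSimpleModule.congr (LinearEquiv.ofInjective ι hι).symm
  let ev : T →ₗ[R] (R ⧸ J →ₗ[R] E) :=
    { toFun := fun x ↦ J.liftQ (LinearMap.toSpanSingleton R E x) fun a ha ↦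
        (Submodule.mem_torsionBySet_iff _ _).mp x.2 ⟨a, ha⟩
      map_add' := fun x y ↦ Submodule.linearMap_qext _ <| LinearMap.ext_ring <|
        smul_add (1 : R) (x : E) (y : E)
      map_smul' := fun r x ↦ Submodule.linearMap_qext _ <| LinearMap.ext_ring <|
        smul_comm (1 : R) r (x : E) }
  have hev : Function.Injective ev := fun x y h ↦ by
    have h1 : (1 : R) • (x : E) = (1 : R) • (y : E) := LinearMap.congr_fun h (J.mkQ 1)
    simpa using h1
  have hT : Module.length R T ≤ Module.length R (R ⧸ J) :=
    (Module.length_le_of_injective ev hev).trans (length_linearMap_le_length _ hess hJ)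
  have hJtop := Module.length_ne_top_iff.mpr hJ
  have hTfin : IsFiniteLength R T := Module.length_ne_top_iff.mp (ne_top_of_le_ne_top hJtop hT)
  have hTE : Module.length R (T →ₗ[R] E) ≤ Module.length R (R ⧸ J) :=
    (length_linearMap_le_length _ hess hTfin).trans hT
  have hTEfin := isFiniteLength_iff_isNoetherian_isArtinian.mp
    (Module.length_ne_top_iff.mp (ne_top_of_le_ne_top hJtop hTE))
  let Ψ : R ⧸ J →ₗ[R] (T →ₗ[R] E) :=
    J.liftQ (LinearMap.toSpanSingleton R (T →ₗ[R] E) T.subtype) fun a ha ↦ by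
      ext x
      exact (Submodule.mem_torsionBySet_iff _ _).mp x.2 ⟨a, ha⟩
  have hΨ : Function.Injective Ψ := by
    rw [injective_iff_map_eq_zero]
    intro q hq
    obtain ⟨r, rfl⟩ := Ideal.Quotient.mk_surjective q
    exact Ideal.Quotient.eq_zero_iff_mem.mpr <| smul_mem_of_smul_torsion_eq_zero hE ι hι J
      fun x hx ↦ LinearMap.congr_fun hq ⟨x, hx⟩
  have hrange : LinearMap.range Ψ = ⊤ := by
    have := hTEfin.1
    have := hTEfin.2
    by_contra h
    refine (Submodule.length_lt h).not_ge (hTE.trans ?_)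
    exact (LinearEquiv.ofInjective Ψ hΨ).length_eq.le
  obtain ⟨q, hq⟩ := LinearMap.range_eq_top.mp hrange f
  obtain ⟨r, rfl⟩ := Ideal.Quotient.mk_surjective q
  exact ⟨r, hq.symm⟩

namespace AdicCompletion

variable {R E : Type*} [CommRing R] [AddCommGroup E] [Module R E] {I : Ideal R}

theorem mem_map_pow_iff (hI : I.FG) {n : ℕ} {a : AdicCompletion I R} :
    a ∈ (I ^ n).map (algebraMap R (AdicCompletion I R)) ↔ eval I R n a = 0 := by
  rw [← Submodule.restrictScalars_mem R, ← Ideal.smul_top_eq_map, pow_smul_top_eq_ker_eval hI,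
    LinearMap.mem_ker]

theorem exists_sub_algebraMap_mem_map_pow (hI : I.FG) (n : ℕ) (a : AdicCompletion I R) :
    ∃ r : R, a - algebraMap R _ r ∈ (I ^ n).map (algebraMap R (AdicCompletion I R)) := by
  obtain ⟨r, hr⟩ := Submodule.Quotient.mk_surjective _ (eval I R n a)
  refine ⟨r, (mem_map_pow_iff hI).mpr ?_⟩
  rw [map_sub, ← hr, sub_eq_zero]
  rfl

theorem mem_pow_of_algebraMap_mem_map_pow (hI : I.FG) {n : ℕ} {r : R}
    (hr : algebraMap R (AdicCompletion I R) r ∈ (I ^ n).map (algebraMap R (AdicCompletion I R))) :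
    r ∈ I ^ n := by
  have h : Submodule.Quotient.mk (p := (I ^ n • ⊤ : Ideal R)) r = 0 := (mem_map_pow_iff hI).mp hr
  simpa using (Submodule.Quotient.mk_eq_zero _).mp h

theorem smul_eq_zero_of_mem_map_pow [Module (AdicCompletion I R) E]
    [IsScalarTower R (AdicCompletion I R) E] {n : ℕ} {x : E} (hx : ∀ r ∈ I ^ n, r • x = 0)
    {a : AdicCompletion I R} (ha : a ∈ (I ^ n).map (algebraMap R (AdicCompletion I R))) :
    a • x = 0 := by
  have hle : (I ^ n).map (algebraMap R (AdicCompletion I R)) ≤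
      LinearMap.ker (LinearMap.toSpanSingleton (AdicCompletion I R) E x) :=
    Ideal.map_le_iff_le_comap.mpr fun r hr ↦ by
      simpa [Ideal.mem_comap] using hx r hr
  exact hle ha

open IsLocalRing in
theorem exists_eq_smul_of_injectiveHull [IsNoetherianRing R] [IsLocalRing R]
    [Module (AdicCompletion (maximalIdeal R) R) E]
    [IsScalarTower R (AdicCompletion (maximalIdeal R) R) E] (hE : Module.Baer R E)
    (ι : ResidueField R →ₗ[R] E) (hι : Function.Injective ι)
    (hess : ∀ U : Submodule R E, U ≠ ⊥ → U ⊓ LinearMap.range ι ≠ ⊥)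
    (htors : ∀ x : E, ∃ n : ℕ, ∀ a ∈ maximalIdeal R ^ n, a • x = 0) (f : E →ₗ[R] E) :
    ∃ a : AdicCompletion (maximalIdeal R) R, ∀ x, f x = a • x := by
  have key (n : ℕ) : ∃ r : R, ∀ x : E, (∀ a ∈ maximalIdeal R ^ n, a • x = 0) → f x = r • x := by
    obtain ⟨r, hr⟩ := exists_eq_smul_subtype_torsion hE ι hι hess (maximalIdeal R ^ n)
      (isFiniteLength_quotient_maximalIdeal_pow n) (f ∘ₗ Submodule.subtype _)
    exact ⟨r, fun x hx ↦ LinearMap.congr_fun hr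
      ⟨x, (Submodule.mem_torsionBySet_iff _ _).mpr fun a ↦ hx a a.2⟩⟩
  choose r hr using key
  let a := mk (maximalIdeal R) R <| AdicCauchySequence.mk _ _ r fun n ↦ by
    rw [SModEq.sub_mem, smul_eq_mul, Ideal.mul_top]
    refine smul_mem_of_smul_torsion_eq_zero hE ι hι _ fun x hx ↦ ?_
    have hx' : ∀ a ∈ maximalIdeal R ^ n, a • x = 0 := fun a ha ↦
      (Submodule.mem_torsionBySet_iff _ _).mp hx ⟨a, ha⟩
    rw [sub_smul, ← hr n x hx', ← hr (n + 1) x fun a ha ↦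
      hx' a (Ideal.pow_le_pow_right n.le_succ ha), sub_self]
  refine ⟨a, fun x ↦ ?_⟩
  obtain ⟨n, hn⟩ := htors x
  have hmem : a - algebraMap R _ (r n) ∈
      (maximalIdeal R ^ n).map (algebraMap R (AdicCompletion (maximalIdeal R) R)) :=
    (mem_map_pow_iff (maximalIdeal R).fg_of_isNoetherianRing).mpr <| by
      rw [map_sub, sub_eq_zero]
      rfl
  rw [hr n x hn, ← sub_eq_zero, ← neg_eq_zero, neg_sub, ← algebraMap_smul
    (AdicCompletion (maximalIdeal R) R) (r n) x, ← sub_smul]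
  exact smul_eq_zero_of_mem_map_pow hn hmem

end AdicCompletion

section InitialForms

variable {R A : Type*} [CommRing R] [CommRing A] [Algebra R A] (I : Ideal R)

/-- The ideal of the Rees algebra of `I` formed by the polynomials whose `i`-th coefficient maps
into `J + I ^ (i + 1) A`: the preimage of the ideal of initial forms of `J`. -/
def initialIdeal (J : Ideal A) : Ideal (reesAlgebra I) where
  carrier := {f | ∀ i, algebraMap R A ((f : Polynomial R).coeff i) ∈
    J ⊔ (I ^ (i + 1)).map (algebraMap R A)}
  add_mem' hf hg i := by
    simpa using add_mem (hf i) (hg i)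
  zero_mem' i := by simp
  smul_mem' c f hf i := by
    rw [smul_eq_mul, MulMemClass.coe_mul, Polynomial.coeff_mul, map_sum]
    refine sum_mem fun ⟨j, k⟩ hjk ↦ ?_
    obtain ⟨u, hu, v, hv, huv⟩ := Submodule.mem_sup.mp (hf k)
    rw [map_mul, ← huv, mul_add]
    refine add_mem (Ideal.mem_sup_left (J.mul_mem_left _ hu)) (Ideal.mem_sup_right ?_)
    rw [← Finset.HasAntidiagonal.mem_antidiagonal.mp hjk, add_assoc, pow_add, Ideal.map_mul]
    exact Ideal.mul_mem_mul (Ideal.mem_map_of_mem _ (c.2 j)) hv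

variable {I}

theorem initialIdeal_mono : Monotone (initialIdeal I (A := A)) :=
  fun _ _ h _ hf i ↦ sup_le_sup_right h _ (hf i)

theorem mem_sup_map_pow_of_initialIdeal_le
    (happrox : ∀ (n : ℕ) (a : A), ∃ r : R, a - algebraMap R A r ∈ (I ^ n).map (algebraMap R A))
    (hcomap : ∀ (n : ℕ) (r : R), algebraMap R A r ∈ (I ^ n).map (algebraMap R A) → r ∈ I ^ n)
    {J J' : Ideal A} (hJ : J ≤ J') (hle : initialIdeal I J' ≤ initialIdeal I J) {x : A}
    (hx : x ∈ J') (n : ℕ) : x ∈ J ⊔ (I ^ n).map (algebraMap R A) := by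
  induction n with
  | zero => simp [Ideal.one_eq_top, Ideal.map_top]
  | succ n ih =>
    obtain ⟨j, hj, y, hy, rfl⟩ := Submodule.mem_sup.mp ih
    obtain ⟨r, hr⟩ := happrox (n + 1) y
    have hr' : r ∈ I ^ n := hcomap n r <| by
      simpa using sub_mem hy (Ideal.map_mono (Ideal.pow_le_pow_right n.le_succ) hr)
    have hyJ : y ∈ J' := by simpa using sub_mem hx (hJ hj)
    let f : reesAlgebra I := ⟨Polynomial.monomial n r, reesAlgebra.monomial_mem.mpr hr'⟩
    have hf : f ∈ initialIdeal I J' := fun i ↦ by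
      by_cases hi : n = i
      · subst hi
        simpa [f] using sub_mem (Ideal.mem_sup_left hyJ) (Ideal.mem_sup_right hr)
      · simp [f, Polynomial.coeff_monomial, hi]
    have hrJ := hle hf n
    rw [Polynomial.coeff_monomial_same] at hrJ
    simpa using add_mem (Ideal.mem_sup_left hj) (add_mem (Ideal.mem_sup_right hr) hrJ)

/-- Annihilators of elements that are closed for the `I`-adic topology are contained in associated
primes, even when `A` is not known to be Noetherian. -/
theorem exists_isAssociatedPrime_of_isClosed_colon [IsNoetherianRing R]
    (happrox : ∀ (n : ℕ) (a : A), ∃ r : R, a - algebraMap R A r ∈ (I ^ n).map (algebraMap R A))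
    (hcomap : ∀ (n : ℕ) (r : R), algebraMap R A r ∈ (I ^ n).map (algebraMap R A) → r ∈ I ^ n)
    {M : Type*} [AddCommGroup M] [Module A M]
    (hclosed : ∀ (y : M) (a : A), (∀ n : ℕ, a ∈ (⊥ : Submodule A M).colon {y} ⊔
      (I ^ n).map (algebraMap R A)) → a ∈ (⊥ : Submodule A M).colon {y}) {x : M} (hx : x ≠ 0) :
    ∃ P : Ideal A, IsAssociatedPrime P M ∧ (⊥ : Submodule A M).colon {x} ≤ P := by
  let c (y : M) : Ideal A := (⊥ : Submodule A M).colon {y}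
  have hmem {y : M} {a : A} : a ∈ c y ↔ a • y = 0 := by simp [c, Submodule.mem_colon_singleton]
  obtain ⟨y, ⟨hy0, hxy⟩, hmax⟩ := (InvImage.wf (fun y ↦ initialIdeal I (c y))
    (wellFounded_gt (α := Ideal (reesAlgebra I)))).has_min {y | y ≠ 0 ∧ c x ≤ c y} ⟨x, hx, le_rfl⟩
  have hmaximal (z : M) (hz : z ≠ 0) (hyz : c y ≤ c z) : c z ≤ c y := fun a ha ↦
    hclosed y a <| mem_sup_map_pow_of_initialIdeal_le happrox hcomap hyz
      (not_lt_iff_le_imp_ge.mp (hmax z ⟨hz, hxy.trans hyz⟩) (initialIdeal_mono hyz)) ha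
  have hprime : (c y).IsPrime := by
    refine ⟨fun h ↦ hy0 ?_, fun {a b} hab ↦ or_iff_not_imp_right.mpr fun hb ↦ ?_⟩
    · simpa using hmem.mp ((Ideal.eq_top_iff_one _).mp h)
    · refine hmaximal (b • y) (mt hmem.mpr hb) (fun d hd ↦ ?_) (hmem.mpr ?_)
      · rw [hmem, smul_comm, hmem.mp hd, smul_zero]
      · rw [smul_smul, hmem.mp hab]
  exact ⟨c y, ⟨hprime, y, hprime.radical.symm⟩, hxy⟩

end InitialForms

theorem IsAssociatedPrime.not_isSMulRegular {A M : Type*} [CommRing A] [AddCommGroup M]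
    [Module A M] {P : Ideal A} (hP : IsAssociatedPrime P M) {a : A} (ha : a ∈ P) :
    ¬ IsSMulRegular M a := by
  obtain ⟨hprime, x, rfl⟩ := hP
  intro hreg
  obtain ⟨n, hn⟩ := ha
  have hx : x = 0 := (hreg.pow n) (by simpa [Submodule.mem_colon_singleton] using hn)
  exact hprime.ne_top (by simp [hx])

/-- Let `(R, m)` be a Noetherian local ring with `m`-adic completion `R̂`, let `E` be
the injective hull of `R/m` (naturally a module over `R̂` compatibly with `R`), and
let `0 ≠ N ⊆ E` be a submodule with `B = Ann_{R̂}(N)`.  Then `N` is a divisible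
`R`-module iff for every associated prime `P` of `R̂/B` the contraction `P ∩ R`
contains no non-zerodivisor of `R`. -/
theorem stmt18 (R : Type) [CommRing R] [IsNoetherianRing R] [IsLocalRing R]
    (E : Type) [AddCommGroup E] [Module R E] [Module.Injective R E]
    [Module (AdicCompletion (IsLocalRing.maximalIdeal R) R) E]
    [IsScalarTower R (AdicCompletion (IsLocalRing.maximalIdeal R) R) E]
    (ι : IsLocalRing.ResidueField R →ₗ[R] E) (hι : Function.Injective ι)
    (hess : ∀ U : Submodule R E, U ≠ ⊥ → U ⊓ LinearMap.range ι ≠ ⊥)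
    (N : Submodule (AdicCompletion (IsLocalRing.maximalIdeal R) R) E) (hN : N ≠ ⊥)
    (B : Ideal (AdicCompletion (IsLocalRing.maximalIdeal R) R))
    (hB : B = N.annihilator) :
    (∀ r ∈ nonZeroDivisors R, ∀ x ∈ N, ∃ y ∈ N, r • y = x) ↔
      (∀ P : Ideal (AdicCompletion (IsLocalRing.maximalIdeal R) R),
        IsAssociatedPrime P ((AdicCompletion (IsLocalRing.maximalIdeal R) R) ⧸ B) →
        ∀ r ∈ P.comap (algebraMap R (AdicCompletion (IsLocalRing.maximalIdeal R) R)),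
          r ∉ nonZeroDivisors R) := by
  have hfg := (IsLocalRing.maximalIdeal R).fg_of_isNoetherianRing
  set A := AdicCompletion (IsLocalRing.maximalIdeal R) R
  have hE : Module.Baer R E := Module.Baer.of_injective inferInstance
  have hsocle : IsLocalRing.maximalIdeal R • LinearMap.range ι = ⊥ := by
    refine le_bot_iff.mp (Submodule.smul_le.mpr ?_)
    rintro r hr _ ⟨y, rfl⟩
    have h0 : algebraMap R (IsLocalRing.ResidueField R) r = 0 :=
      (IsLocalRing.residue_eq_zero_iff r).mpr hr
    rw [Submodule.mem_bot, ← map_smul, Algebra.smul_def, h0, zero_mul, map_zero]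
  have htors := exists_pow_smul_eq_zero_of_essential (IsLocalRing.maximalIdeal R) _ hsocle hess
  have hsmul (b : A) : b ∈ B ↔ ∀ w ∈ N, b • w = 0 := by rw [hB, Submodule.mem_annihilator]
  constructor
  · intro hdiv P hP r hr hreg
    refine hP.not_isSMulRegular (Ideal.mem_comap.mp hr) ?_
    rw [isSMulRegular_iff_right_eq_zero_of_smul]
    intro q hq
    obtain ⟨b, rfl⟩ := Ideal.Quotient.mk_surjective q
    rw [Algebra.smul_def, Ideal.Quotient.algebraMap_eq, ← map_mul,
      Ideal.Quotient.eq_zero_iff_mem, hsmul] at hq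
    rw [Ideal.Quotient.eq_zero_iff_mem, hsmul]
    intro w hw
    obtain ⟨v, hv, rfl⟩ := hdiv r hreg w hw
    rw [← algebraMap_smul A r v, smul_smul, mul_comm]
    exact hq v hv
  · intro hass r hreg x hx
    by_contra hxr
    let W : Submodule R E := (N.restrictScalars R).map (LinearMap.lsmul R E r)
    obtain ⟨φ, hφ⟩ := exists_linearMap_apply_ne_zero hE ι hι (m := W.mkQ x) fun h ↦
      hxr ((Submodule.Quotient.mk_eq_zero _).mp h)
    obtain ⟨a, ha⟩ :=
      AdicCompletion.exists_eq_smul_of_injectiveHull hE ι hι hess htors (φ ∘ₗ W.mkQ)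
    have haB : Ideal.Quotient.mk B a ≠ 0 := fun h ↦
      hφ ((ha x).trans ((hsmul a).mp (Ideal.Quotient.eq_zero_iff_mem.mp h) x hx))
    have hclosed (y : A ⧸ B) (d : A) (hd : ∀ n : ℕ, d ∈ (⊥ : Submodule A (A ⧸ B)).colon {y} ⊔
        (IsLocalRing.maximalIdeal R ^ n).map (algebraMap R A)) :
        d ∈ (⊥ : Submodule A (A ⧸ B)).colon {y} := by
      obtain ⟨b, rfl⟩ := Ideal.Quotient.mk_surjective y
      have hcolon (e : A) : e ∈ (⊥ : Submodule A (A ⧸ B)).colon {Ideal.Quotient.mk B b} ↔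
          ∀ w ∈ N, e • b • w = 0 := by
        rw [Submodule.mem_colon_singleton, Submodule.mem_bot, Algebra.smul_def,
          Ideal.Quotient.algebraMap_eq, ← map_mul, Ideal.Quotient.eq_zero_iff_mem, hsmul]
        simp_rw [mul_smul]
      refine (hcolon d).mpr fun w hw ↦ ?_
      obtain ⟨n, hn⟩ := htors (b • w)
      obtain ⟨q, hq, l, hl, rfl⟩ := Submodule.mem_sup.mp (hd n)
      rw [add_smul, (hcolon q).mp hq w hw, zero_add]
      exact AdicCompletion.smul_eq_zero_of_mem_map_pow hn hl
    obtain ⟨P, hP, hle⟩ := exists_isAssociatedPrime_of_isClosed_colon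
      (I := IsLocalRing.maximalIdeal R) (AdicCompletion.exists_sub_algebraMap_mem_map_pow hfg)
      (fun _ _ ↦ AdicCompletion.mem_pow_of_algebraMap_mem_map_pow hfg) hclosed haB
    refine hass P hP r (hle ?_) hreg
    rw [Submodule.mem_colon_singleton, Submodule.mem_bot, Algebra.smul_def,
      Ideal.Quotient.algebraMap_eq, ← map_mul, Ideal.Quotient.eq_zero_iff_mem, hsmul]
    intro w hw
    have hrw : W.mkQ (r • w) = 0 := (Submodule.Quotient.mk_eq_zero _).mpr ⟨w, hw, rfl⟩
    rw [mul_comm, mul_smul, algebraMap_smul, ← ha, LinearMap.comp_apply, hrw, map_zero]
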